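/- Let τ be a complex number with Re(τ) > 0 and define 𝓛Λ(τ, s) := -τ^{s/2}/s + τ^{s/2}·∫_{1}^{∞} x^{s/2 - 1}·ψ(τx) dx for s ≠ 0. Then for every complex number s with s ≠ 0 and s ≠ 1, the completed Riemann zeta function satisfies Λ(s) = 𝓛Λ(τ, s) + 𝓛Λ(1/τ, 1 - s). -/

import Mathlib

open MeasureTheory Complex Real

/-- For `Re z > 0`, `ψ z = ∑_{n ≥ 1} exp (-π n² z)`. -/
noncomputable def psiC (z : ℂ) : ℂ := ∑' n : ℕ, Complex.exp (-(π : ℂ) * ((n : ℂ) + 1) ^ 2 * z)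

/-- `𝓛Λ(τ, s) = -τ^{s/2}/s + τ^{s/2} ∫_1^∞ x^{s/2-1} ψ(τ x) dx`. -/
noncomputable def LavrikLambdaTau (τ s : ℂ) : ℂ :=
  -τ ^ (s / 2) / s + τ ^ (s / 2) * ∫ x in Set.Ioi (1 : ℝ), (x : ℂ) ^ (s / 2 - 1) * psiC (τ * x)

open Set Filter Topology Asymptotics

lemma ofReal_mul_cpow {a : ℝ} (ha : 0 < a) {τ : ℂ} (hτ : τ ≠ 0) (z : ℂ) :
    ((a : ℂ) * τ) ^ z = (a : ℂ) ^ z * τ ^ z := by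
  have ha' : (a : ℂ) ≠ 0 := ofReal_ne_zero.mpr ha.ne'
  rw [cpow_def_of_ne_zero (mul_ne_zero ha' hτ), cpow_def_of_ne_zero ha', cpow_def_of_ne_zero hτ,
    Complex.log_ofReal_mul ha hτ, ofReal_log ha.le, add_mul, Complex.exp_add]

lemma norm_cpow_mul_exp_neg_mul {z r : ℂ} {t : ℝ} (ht : 0 < t) :
    ‖(t : ℂ) ^ (z - 1) * cexp (-(r * t))‖ = t ^ (z.re - 1) * rexp (-(r.re * t)) := by
  rw [norm_mul, norm_cpow_eq_rpow_re_of_pos ht, norm_exp]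
  simp

lemma integrableOn_rpow_mul_exp_neg_mul {a b : ℝ} (ha : -1 < a) (hb : 0 < b) :
    IntegrableOn (fun t : ℝ ↦ t ^ a * rexp (-(b * t))) (Ioi 0) := by
  simpa using integrableOn_rpow_mul_exp_neg_mul_rpow ha one_pos hb

lemma continuousOn_cpow_mul_exp_neg_mul (z r : ℂ) :
    ContinuousOn (fun t : ℝ ↦ (t : ℂ) ^ z * cexp (-(r * t))) (Ioi 0) := by
  refine .mul (fun t ht ↦ ?_) (by fun_prop)
  exact ((continuousAt_ofReal_cpow_const t z (Or.inr (ne_of_gt ht)))).continuousWithinAt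

lemma integrableOn_cpow_mul_exp_neg_mul {z r : ℂ} (hz : 0 < z.re) (hr : 0 < r.re) :
    IntegrableOn (fun t : ℝ ↦ (t : ℂ) ^ (z - 1) * cexp (-(r * t))) (Ioi 0) := by
  refine (integrableOn_rpow_mul_exp_neg_mul (by linarith : -1 < z.re - 1) hr).mono'
    ((continuousOn_cpow_mul_exp_neg_mul _ r).aestronglyMeasurable measurableSet_Ioi) ?_
  filter_upwards [ae_restrict_mem measurableSet_Ioi] with t ht
  exact (norm_cpow_mul_exp_neg_mul ht).le

lemma differentiableAt_integral_cpow_mul_exp_neg_mul {z r : ℂ} (hz : 0 < z.re) (hr : 0 < r.re) :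
    DifferentiableAt ℂ (fun r ↦ ∫ t in Ioi (0 : ℝ), (t : ℂ) ^ (z - 1) * cexp (-(r * t))) r := by
  have hU : {w : ℂ | r.re / 2 < w.re} ∈ 𝓝 r :=
    (isOpen_lt continuous_const continuous_re).mem_nhds (by simpa using half_lt_self hr)
  refine (hasDerivAt_integral_of_dominated_loc_of_deriv_le (𝕜 := ℂ)
    (bound := fun t ↦ t ^ z.re * rexp (-(r.re / 2 * t)))
    (F' := fun w t ↦ (t : ℂ) ^ (z - 1) * (cexp (-(w * t)) * -t)) hU
    (.of_forall fun w ↦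
      (continuousOn_cpow_mul_exp_neg_mul _ w).aestronglyMeasurable measurableSet_Ioi)
    (integrableOn_cpow_mul_exp_neg_mul hz hr) ?_ ?_
    (integrableOn_rpow_mul_exp_neg_mul (by linarith) (half_pos hr)) ?_).2.differentiableAt
  · simp_rw [← mul_assoc]
    exact ((continuousOn_cpow_mul_exp_neg_mul _ r).mul (by fun_prop)).aestronglyMeasurable
      measurableSet_Ioi
  · filter_upwards [ae_restrict_mem measurableSet_Ioi] with t (ht : 0 < t) w hw
    rw [← mul_assoc, norm_mul, norm_cpow_mul_exp_neg_mul ht, norm_neg, norm_real,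
      Real.norm_of_nonneg ht.le, mul_right_comm]
    nth_rw 2 [← Real.rpow_one t]
    rw [← Real.rpow_add ht, sub_add_cancel]
    have : r.re / 2 < w.re := hw
    gcongr
  · refine .of_forall fun t w _ ↦ ?_
    have h : HasDerivAt (fun w : ℂ ↦ -(w * t)) (-t : ℂ) w := by
      simpa using! ((hasDerivAt_id w).mul_const (t : ℂ)).neg
    exact h.cexp.const_mul _

/-- Gamma integral with a complex rate, extending `Complex.integral_cpow_mul_exp_neg_mul_Ioi`. -/
lemma integral_cpow_mul_exp_neg_complex_mul_Ioi {z r : ℂ} (hz : 0 < z.re) (hr : 0 < r.re) :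
    ∫ t in Ioi (0 : ℝ), (t : ℂ) ^ (z - 1) * cexp (-(r * t)) = r ^ (-z) * Complex.Gamma z := by
  have hU : IsOpen {w : ℂ | 0 < w.re} := isOpen_lt continuous_const continuous_re
  have hJ : AnalyticOnNhd ℂ
      (fun r ↦ ∫ t in Ioi (0 : ℝ), (t : ℂ) ^ (z - 1) * cexp (-(r * t))) {w : ℂ | 0 < w.re} :=
    DifferentiableOn.analyticOnNhd (fun w hw ↦
      (differentiableAt_integral_cpow_mul_exp_neg_mul hz hw).differentiableWithinAt) hU
  have hG : AnalyticOnNhd ℂ (fun r : ℂ ↦ r ^ (-z) * Complex.Gamma z) {w : ℂ | 0 < w.re} :=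
    DifferentiableOn.analyticOnNhd (fun w hw ↦ ((differentiableAt_id.cpow_const
      (Or.inl hw)).mul_const _).differentiableWithinAt) hU
  refine hJ.eqOn_of_preconnected_of_frequently_eq hG (convex_halfSpace_re_gt 0).isPreconnected
    (z₀ := 1) (by simp) ?_ hr
  have hlim : Tendsto (fun x : ℝ ↦ (x : ℂ)) (𝓝[>] 1) (𝓝[≠] 1) := by
    refine tendsto_nhdsWithin_iff.mpr ⟨?_, ?_⟩
    · exact (continuous_ofReal.tendsto' 1 1 (by simp)).mono_left nhdsWithin_le_nhds
    · filter_upwards [self_mem_nhdsWithin] with x (hx : 1 < x)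
      simpa using hx.ne'
  refine hlim.frequently (Eventually.frequently ?_)
  filter_upwards [self_mem_nhdsWithin] with x (hx : 1 < x)
  have hx0 : 0 < x := one_pos.trans hx
  rw [integral_cpow_mul_exp_neg_mul_Ioi hz hx0, one_div, inv_cpow_ofReal_nonneg hx0.le, cpow_neg]

lemma im_I_mul {τ : ℂ} (hτ : 0 < τ.re) {x : ℝ} (hx : 0 < x) : 0 < (I * (τ * x)).im := by
  simpa using mul_pos hτ hx

lemma inv_re_pos {τ : ℂ} (hτ : 0 < τ.re) : 0 < τ⁻¹.re := by
  rw [inv_re]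
  exact div_pos hτ (normSq_pos.mpr (ne_zero_of_re_pos hτ))

lemma hasSum_psiC {z : ℂ} (hz : 0 < z.re) :
    HasSum (fun n : ℕ ↦ cexp (-(π : ℂ) * ((n : ℂ) + 1) ^ 2 * z))
      ((jacobiTheta (I * z) - 1) / 2) := by
  convert! hasSum_nat_jacobiTheta (τ := I * z) (by simpa) using 3 with n
  linear_combination (-π * ((n : ℂ) + 1) ^ 2 * z) * I_sq

lemma psiC_eq {z : ℂ} (hz : 0 < z.re) : psiC z = (jacobiTheta (I * z) - 1) / 2 :=
  (hasSum_psiC hz).tsum_eq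

lemma locallyIntegrableOn_jacobiTheta {τ : ℂ} (hτ : 0 < τ.re) :
    LocallyIntegrableOn (fun x : ℝ ↦ jacobiTheta (I * (τ * x))) (Ioi 0) := by
  refine ContinuousOn.locallyIntegrableOn (fun x hx ↦ ?_) measurableSet_Ioi
  exact ((continuousAt_jacobiTheta (im_I_mul hτ hx)).comp
    (f := fun x : ℝ ↦ I * (τ * x)) (by fun_prop)).continuousWithinAt

lemma isBigO_jacobiTheta_sub_one {τ : ℂ} (hτ : 0 < τ.re) (r : ℝ) :
    (fun x : ℝ ↦ jacobiTheta (I * (τ * x)) - 1) =O[atTop] (· ^ r) := by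
  have hlim : Tendsto (fun x : ℝ ↦ I * (τ * x)) atTop (comap im atTop) := by
    refine tendsto_comap_iff.mpr ?_
    simpa [Function.comp_def] using tendsto_id.const_mul_atTop hτ
  refine (isBigO_at_im_infty_jacobiTheta_sub_one.comp_tendsto hlim).trans ?_
  convert! (isLittleO_exp_neg_mul_rpow_atTop (mul_pos pi_pos hτ) r).isBigO using 2 with x
  simp
  ring

lemma jacobiTheta_inv_smul {τ : ℂ} (hτ : 0 < τ.re) {x : ℝ} (hx : 0 < x) :
    jacobiTheta (I * (τ * (1 / x : ℝ))) =
      τ ^ (-(1 / 2) : ℂ) * ((x ^ (1 / 2 : ℝ) : ℝ) : ℂ) * jacobiTheta (I * (τ⁻¹ * x)) := by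
  have h0 : τ ≠ 0 := ne_zero_of_re_pos hτ
  have hx' : (x : ℂ) ≠ 0 := ofReal_ne_zero.mpr hx.ne'
  rw [jacobiTheta_eq_jacobiTheta₂, jacobiTheta₂_functional_equation, jacobiTheta_eq_jacobiTheta₂]
  have h1 : -I * (I * (τ * (1 / x : ℝ))) = ((x⁻¹ : ℝ) : ℂ) * τ := by
    push_cast
    linear_combination (-τ / x) * I_sq
  have h2 : -1 / (I * (τ * ((1 / x : ℝ) : ℂ))) = I * (τ⁻¹ * x) := by
    push_cast
    field_simp
    simp
  rw [h1, h2, ofReal_mul_cpow (inv_pos.mpr hx) h0, ofReal_cpow hx.le, ofReal_inv,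
    inv_cpow_ofReal_nonneg hx.le, cpow_neg]
  simp

/-- The theta series along the rays through `τ` and `τ⁻¹`, as a pair related by a functional
equation of weight `1 / 2`. -/
noncomputable def rayThetaFEPair {τ : ℂ} (hτ : 0 < τ.re) : WeakFEPair ℂ where
  f x := jacobiTheta (I * (τ * x))
  g x := jacobiTheta (I * (τ⁻¹ * x))
  k := 1 / 2
  ε := τ ^ (-(1 / 2) : ℂ)
  f₀ := 1
  g₀ := 1
  hf_int := locallyIntegrableOn_jacobiTheta hτ
  hg_int := locallyIntegrableOn_jacobiTheta (inv_re_pos hτ)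
  hk := by norm_num
  hε := by simp [cpow_eq_zero_iff, ne_zero_of_re_pos hτ]
  h_feq _ hx := jacobiTheta_inv_smul hτ hx
  hf_top := isBigO_jacobiTheta_sub_one hτ
  hg_top := isBigO_jacobiTheta_sub_one (inv_re_pos hτ)

lemma WeakFEPair.Λ₀_eq_integral_add_integral (P : WeakFEPair ℂ) (z : ℂ) :
    P.Λ₀ z = (∫ x in Ioi (1 : ℝ), (x : ℂ) ^ (z - 1) * (P.f x - P.f₀)) +
      P.ε * ∫ x in Ioi (1 : ℝ), (x : ℂ) ^ (P.k - z - 1) * (P.g x - P.g₀) := by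
  set u : ℝ → ℂ := (Ioi 1).indicator P.f_modif
  set v : ℝ → ℂ := (Ioo 0 1).indicator P.f_modif
  have hint : MellinConvergent P.f_modif z := P.isStrongFEPair_toStrongFEPair.hasMellin z |>.1
  have hind (s : Set ℝ) (hs : MeasurableSet s) : MellinConvergent (s.indicator P.f_modif) z := by
    refine (IntegrableOn.indicator hint hs).congr_fun (fun x _ ↦ ?_) measurableSet_Ioi
    exact indicator_smul_apply s _ _ x
  have huv : P.f_modif = fun x ↦ u x + v x := by
    ext x
    simp only [u, v, WeakFEPair.f_modif, Pi.add_apply, indicator_apply, mem_Ioi, mem_Ioo]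
    grind
  have hsub : Ioi (1 : ℝ) ⊆ Ioi 0 := Ioi_subset_Ioi zero_le_one
  have hcut (F : ℝ → ℂ) : ∫ x in Ioi (0 : ℝ), (Ioi 1).indicator F x = ∫ x in Ioi (1 : ℝ), F x := by
    rw [setIntegral_indicator measurableSet_Ioi, inter_eq_right.mpr hsub]
  rw [WeakFEPair.Λ₀, huv, (hasMellin_add (hind _ measurableSet_Ioi) (hind _ measurableSet_Ioo)).2]
  congr 1
  · rw [← hcut, mellin]
    refine setIntegral_congr_fun measurableSet_Ioi fun x _ ↦ ?_
    simp only [WeakFEPair.f_modif, Pi.add_apply, indicator_apply, mem_Ioi, mem_Ioo, smul_eq_mul]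
    grind
  · rw [← integral_const_mul, ← hcut, ← neg_neg z, ← mellin_comp_inv, neg_neg, mellin]
    refine setIntegral_congr_fun measurableSet_Ioi fun x (hx : 0 < x) ↦ ?_
    by_cases hx1 : 1 < x
    · have h1 : x⁻¹ ∈ Ioo (0 : ℝ) 1 := ⟨inv_pos.mpr hx, inv_lt_one_of_one_lt₀ hx1⟩
      have hg : P.g_modif x = P.g x - P.g₀ := by
        simp [WeakFEPair.g_modif, hx1, hx1.le]
      simp only [indicator_of_mem h1, indicator_of_mem (mem_Ioi.mpr hx1)]
      rw [← one_div, P.hf_modif_FE x hx, hg, show (P.k : ℂ) - z - 1 = -z - 1 + P.k by ring,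
        cpow_add _ _ (ofReal_ne_zero.mpr hx.ne'), ofReal_cpow hx.le, smul_eq_mul, smul_eq_mul]
      ring
    · have h1 : x⁻¹ ∉ Ioo (0 : ℝ) 1 := fun h ↦ hx1 ((inv_lt_one₀ hx).mp h.2)
      simp [indicator_of_notMem h1, hx1]

lemma LavrikLambdaTau_add_eq {τ : ℂ} (hτ : 0 < τ.re) (s : ℂ) :
    LavrikLambdaTau τ s + LavrikLambdaTau (1 / τ) (1 - s) =
      τ ^ (s / 2) / 2 * (rayThetaFEPair hτ).Λ (s / 2) := by
  have h0 : τ ≠ 0 := ne_zero_of_re_pos hτ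
  have harg : τ.arg ≠ π := (mem_slitPlane_iff_arg.mp (Or.inl hτ)).1
  have hI {τ : ℂ} (hτ : 0 < τ.re) (z : ℂ) :
      ∫ x in Ioi (1 : ℝ), (x : ℂ) ^ z * psiC (τ * x) =
        (∫ x in Ioi (1 : ℝ), (x : ℂ) ^ z * (jacobiTheta (I * (τ * x)) - 1)) / 2 := by
    rw [← integral_div]
    refine setIntegral_congr_fun measurableSet_Ioi fun x (hx : 1 < x) ↦ ?_
    rw [psiC_eq (by simpa using mul_pos hτ (one_pos.trans hx)), mul_div_assoc]
  have hpow : (1 / τ) ^ ((1 - s) / 2) = τ ^ (s / 2) * τ ^ (-(1 / 2) : ℂ) := by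
    rw [one_div, inv_cpow _ _ harg, ← cpow_neg, ← cpow_add _ _ h0]
    ring_nf
  rw [WeakFEPair.Λ, WeakFEPair.Λ₀_eq_integral_add_integral, LavrikLambdaTau, LavrikLambdaTau, hpow,
    one_div τ, hI hτ, hI (inv_re_pos hτ)]
  have he : (1 - s) / 2 - 1 = ((1 / 2 : ℝ) : ℂ) - s / 2 - 1 := by push_cast; ring
  have hd : ((1 / 2 : ℝ) : ℂ) - s / 2 = (1 - s) / 2 := by push_cast; ring
  simp only [rayThetaFEPair, he, hd, smul_eq_mul, mul_one, div_div_eq_mul_div]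
  ring

lemma hasSum_mellin_jacobiTheta_sub_one {τ z : ℂ} (hτ : 0 < τ.re) (hz : 1 / 2 < z.re) :
    HasSum (fun n : ℕ ↦ (π * ((n : ℂ) + 1) ^ 2 * τ) ^ (-z) * Complex.Gamma z)
      (mellin (fun x : ℝ ↦ jacobiTheta (I * (τ * x)) - 1) z / 2) := by
  have hz0 : 0 < z.re := by linarith
  have hre (n : ℕ) : (π * ((n : ℂ) + 1) ^ 2 * τ).re = π * ((n : ℝ) + 1) ^ 2 * τ.re := by
    rw [← re_ofReal_mul]
    push_cast
    rfl
  have hpos (n : ℕ) : 0 < (π * ((n : ℂ) + 1) ^ 2 * τ).re := by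
    rw [hre]
    positivity
  have hmell : mellin (fun x : ℝ ↦ jacobiTheta (I * (τ * x)) - 1) z / 2 =
      ∫ t in Ioi (0 : ℝ), ∑' n : ℕ,
        (t : ℂ) ^ (z - 1) * cexp (-(π * ((n : ℂ) + 1) ^ 2 * τ * t)) := by
    rw [mellin, ← integral_div]
    refine setIntegral_congr_fun measurableSet_Ioi fun t (ht : 0 < t) ↦ ?_
    simp only [smul_eq_mul]
    rw [tsum_mul_left, mul_div_assoc, ← psiC_eq (by simpa using mul_pos hτ ht), psiC]
    congr! 3 with n
    congr 1
    ring
  rw [hmell]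
  simp_rw [← integral_cpow_mul_exp_neg_complex_mul_Ioi hz0 (hpos _)]
  refine hasSum_integral_of_summable_integral_norm
    (fun n ↦ integrableOn_cpow_mul_exp_neg_mul hz0 (hpos n)) ?_
  have hnorm (n : ℕ) : ∫ t in Ioi (0 : ℝ),
      ‖(t : ℂ) ^ (z - 1) * cexp (-(π * ((n : ℂ) + 1) ^ 2 * τ * t))‖ =
        (π * τ.re) ^ (-z.re) * Real.Gamma z.re * (1 / ((n : ℝ) + 1) ^ (2 * z.re)) := by
    rw [setIntegral_congr_fun measurableSet_Ioi fun t ht ↦ norm_cpow_mul_exp_neg_mul ht,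
      Real.integral_rpow_mul_exp_neg_mul_Ioi hz0 (hpos n), hre, one_div,
      Real.inv_rpow (by positivity), ← Real.rpow_neg (by positivity), mul_right_comm,
      Real.mul_rpow (by positivity) (by positivity),
      Real.rpow_neg (by positivity : (0 : ℝ) ≤ (n + 1) ^ 2), Real.rpow_mul (by positivity),
      Real.rpow_two, one_div]
    ring
  simp_rw [hnorm]
  refine Summable.mul_left _ ?_
  have := (summable_nat_add_iff 1).mpr
    (Real.summable_one_div_nat_rpow.mpr (by linarith : 1 < 2 * z.re))
  simpa using this

lemma completedRiemannZeta_eq_of_one_lt_re {τ s : ℂ} (hτ : 0 < τ.re) (hs : 1 < s.re) :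
    completedRiemannZeta s = τ ^ (s / 2) / 2 * (rayThetaFEPair hτ).Λ (s / 2) := by
  have h0 : τ ≠ 0 := ne_zero_of_re_pos hτ
  have hz : 1 / 2 < (s / 2).re := by
    rw [div_ofNat_re]
    linarith
  rw [← ((rayThetaFEPair hτ).hasMellin hz).2]
  have hsum := (hasSum_mellin_jacobiTheta_sub_one hτ hz).mul_left (τ ^ (s / 2))
  rw [div_mul_eq_mul_div, mul_div_assoc]
  refine Eq.trans ?_ hsum.tsum_eq
  rw [completedZeta_eq_tsum_of_one_lt_re hs, ← zeta_eq_tsum_one_div_nat_cpow hs,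
    zeta_eq_tsum_one_div_nat_add_one_cpow hs, ← tsum_mul_left]
  refine tsum_congr fun n ↦ ?_
  have hn : (0 : ℝ) < n + 1 := by positivity
  have hcast : (π : ℂ) * ((n : ℂ) + 1) ^ 2 * τ = ((π * ((n : ℝ) + 1) ^ 2 : ℝ) : ℂ) * τ := by
    push_cast
    rfl
  have hsq : ((((n : ℝ) + 1) ^ 2 : ℝ) : ℂ) ^ (-(s / 2)) = 1 / ((n : ℂ) + 1) ^ s := by
    rw [← Real.rpow_two, ← cpow_mul_ofReal_nonneg hn.le, one_div, ← cpow_neg]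
    push_cast
    ring_nf
  rw [hcast, ofReal_mul_cpow (by positivity) h0, ofReal_mul, mul_cpow_ofReal_nonneg pi_pos.le
    (by positivity), hsq, cpow_neg τ, neg_div]
  field_simp [cpow_ne_zero_iff_of_exponent_ne_zero, h0]

theorem completed_zeta_splitting (τ : ℂ) (hτ : 0 < τ.re) (s : ℂ) (hs0 : s ≠ 0) (hs1 : s ≠ 1) :
    completedRiemannZeta s = LavrikLambdaTau τ s + LavrikLambdaTau (1 / τ) (1 - s) := by
  have h0 : τ ≠ 0 := ne_zero_of_re_pos hτ
  rw [LavrikLambdaTau_add_eq hτ]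
  have hfin : ({0, 1} : Set ℂ).Finite := by simp
  have hU : IsOpen ({0, 1}ᶜ : Set ℂ) := hfin.isClosed.isOpen_compl
  have hΛ : AnalyticOnNhd ℂ completedRiemannZeta {0, 1}ᶜ :=
    DifferentiableOn.analyticOnNhd (fun w hw ↦ by
      simp only [mem_compl_iff, mem_insert_iff, mem_singleton_iff, not_or] at hw
      exact (differentiableAt_completedZeta hw.1 hw.2).differentiableWithinAt) hU
  have hP : AnalyticOnNhd ℂ
      (fun s ↦ τ ^ (s / 2) / 2 * (rayThetaFEPair hτ).Λ (s / 2)) {0, 1}ᶜ := by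
    refine DifferentiableOn.analyticOnNhd (fun w hw ↦ ?_) hU
    simp only [mem_compl_iff, mem_insert_iff, mem_singleton_iff, not_or] at hw
    have hk : w / 2 ≠ ((rayThetaFEPair hτ).k : ℂ) := by
      simp only [rayThetaFEPair]
      push_cast
      intro h
      exact hw.2 (by linear_combination 2 * h)
    have hd := (rayThetaFEPair hτ).differentiableAt_Λ (s := w / 2)
      (Or.inl (div_ne_zero hw.1 two_ne_zero)) (Or.inl hk)
    have hd' : DifferentiableAt ℂ (fun s : ℂ ↦ τ ^ (s / 2)) w :=
      (differentiableAt_id.div_const 2).const_cpow (Or.inl h0)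
    exact ((hd'.div_const 2).mul
      (hd.comp w (differentiableAt_id.div_const (2 : ℂ)))).differentiableWithinAt
  refine hΛ.eqOn_of_preconnected_of_eventuallyEq hP (z₀ := 2)
    (hfin.countable.isConnected_compl_of_one_lt_rank (by simp)).isPreconnected (by norm_num) ?_
    (by simp [hs0, hs1])
  exact eventuallyEq_of_mem ((isOpen_lt continuous_const continuous_re).mem_nhds (by norm_num))
    fun w hw ↦ completedRiemannZeta_eq_of_one_lt_re hτ hw
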